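/- arXiv:2409.18206 — 5 statements merged into one kernel-verified Lean document; each statement's English description precedes it below -/
import Mathlib

section
/- Let N ≥ 1 be an integer coprime to 6, and let hA, hB, hC : ℤ × ℤ → ZMod N be functions, all with finite support, satisfying for every v = (i,j) ∈ ℤ × ℤ the conditions: 4·hA(i,j) = hC(i,j) + hB(i+1,j) + hB(i,j−1) + hC(i,j−1); 4·hB(i,j) = hC(i,j) + hA(i,j+1) + hA(i−1,j) + hC(i−1,j); 4·hC(i,j) = hA(i,j) + hB(i+1,j) + hB(i,j) + hA(i,j+1), all in ZMod N. Then hA, hB, hC are identically zero. -/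
/-- A finitely supported function on `ℤ × ℤ` annihilated by a regular multiple of the Laplacian
of the triangular lattice vanishes: evaluate at `m + (1, 1)` for the lexicographically largest
point `m` of the support. -/
theorem eq_zero_of_triangular_harmonic {R : Type*} [CommRing R] {c : R}
    (hc : ∀ r : R, c * r = 0 → r = 0) {f : ℤ × ℤ → R} (hf : (Function.support f).Finite)
    (h : ∀ i j : ℤ, c * (6 * f (i, j)) = c * (f (i + 1, j) + f (i - 1, j) + f (i, j + 1)
      + f (i, j - 1) + f (i + 1, j + 1) + f (i - 1, j - 1))) :
    f = 0 := by
  by_contra hne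
  obtain ⟨m, hm, hmax⟩ :=
    Set.exists_max_image _ toLex hf (Function.support_nonempty_iff.2 hne)
  obtain ⟨a, b⟩ := m
  have hzero : ∀ i j : ℤ, (a < i ∨ a = i ∧ b < j) → f (i, j) = 0 := by
    intro i j hij
    by_contra hfij
    exact (hmax (i, j) hfij).not_gt (Prod.Lex.toLex_lt_toLex.2 hij)
  have key := h (a + 1) (b + 1)
  rw [hzero (a + 1) (b + 1) (by lia), hzero (a + 1 + 1) (b + 1) (by lia),
    hzero (a + 1 - 1) (b + 1) (by lia), hzero (a + 1) (b + 1 + 1) (by lia),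
    hzero (a + 1) (b + 1 - 1) (by lia), hzero (a + 1 + 1) (b + 1 + 1) (by lia),
    add_sub_cancel_right, add_sub_cancel_right] at key
  exact hm (hc _ (by linear_combination -key))

/-- On the infinite Kagome lattice (three sublattices `A`, `B`, `C` indexed by `ℤ × ℤ`),
if `N` is coprime to `6`, any finitely supported `ZMod N`-valued discrete harmonic triple
vanishes identically. -/
theorem kagome_no_finite_harmonic (N : ℕ) (hN : 1 ≤ N) (hcop : Nat.Coprime N 6)
    (hA hB hC : ℤ × ℤ → ZMod N)
    (hfinA : (Function.support hA).Finite) (hfinB : (Function.support hB).Finite)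
    (hfinC : (Function.support hC).Finite)
    (hharmA : ∀ i j : ℤ,
      4 * hA (i, j) = hC (i, j) + hB (i + 1, j) + hB (i, j - 1) + hC (i, j - 1))
    (hharmB : ∀ i j : ℤ,
      4 * hB (i, j) = hC (i, j) + hA (i, j + 1) + hA (i - 1, j) + hC (i - 1, j))
    (hharmC : ∀ i j : ℤ,
      4 * hC (i, j) = hA (i, j) + hB (i + 1, j) + hB (i, j) + hA (i, j + 1)) :
    hA = 0 ∧ hB = 0 ∧ hC = 0 := by
  have h6 : IsUnit (6 : ZMod N) := by
    exact_mod_cast (ZMod.isUnit_iff_coprime 6 N).2 hcop.symm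
  have h4 : IsUnit (4 : ZMod N) := by
    have hcop2 : Nat.Coprime N 2 := hcop.coprime_dvd_right (by norm_num)
    exact_mod_cast (ZMod.isUnit_iff_coprime 4 N).2 (hcop2.pow_right 2).symm
  have hreg : ∀ r : ZMod N, 6 * r = 0 → r = 0 := fun r => h6.mul_right_eq_zero.1
  -- The coefficients below are the first two rows of the adjugate of the symbol matrix of the
  -- system, whose determinant is six times the symbol of the triangular Laplacian.
  have hA0 : hA = 0 := by
    refine eq_zero_of_triangular_harmonic hreg hfinA fun i j => ?_
    linear_combination (norm := ring_nf)
      14 * hharmA i j - hharmA (i + 1) j - hharmA (i - 1) j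
        + 5 * hharmB (i + 1) j + 5 * hharmB i (j - 1) + hharmB i j + hharmB (i + 1) (j - 1)
        + 5 * hharmC i j + hharmC (i + 1) j + 5 * hharmC i (j - 1) + hharmC (i - 1) (j - 1)
  have hB0 : hB = 0 := by
    refine eq_zero_of_triangular_harmonic hreg hfinB fun i j => ?_
    linear_combination (norm := ring_nf)
      5 * hharmA i (j + 1) + 5 * hharmA (i - 1) j + hharmA i j + hharmA (i - 1) (j + 1)
        + 14 * hharmB i j - hharmB i (j + 1) - hharmB i (j - 1)
        + 5 * hharmC i j + 5 * hharmC (i - 1) j + hharmC i (j + 1) + hharmC (i - 1) (j - 1)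
  refine ⟨hA0, hB0, funext fun ⟨i, j⟩ => h4.mul_right_eq_zero.1 ?_⟩
  simpa [hA0, hB0] using hharmC i j
end

section
/- Let N ≥ 2 be an integer divisible by 2 or by 3. Then there exist functions hA, hB, hC : ℤ × ℤ → ZMod N, all with finite support and not all identically zero, satisfying for every (i,j) ∈ ℤ × ℤ the conditions: 4·hA(i,j) = hC(i,j) + hB(i+1,j) + hB(i,j−1) + hC(i,j−1); 4·hB(i,j) = hC(i,j) + hA(i,j+1) + hA(i−1,j) + hC(i−1,j); 4·hC(i,j) = hA(i,j) + hB(i+1,j) + hB(i,j) + hA(i,j+1), all in ZMod N. -/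
/-- If `N ≥ 2` is divisible by `2` or by `3`, then `ZMod N` has a nonzero element killed by `6`. -/
theorem ZMod.exists_ne_zero_six_mul_eq_zero (N : ℕ) (hN : 2 ≤ N) (hdvd : 2 ∣ N ∨ 3 ∣ N) :
    ∃ c : ZMod N, c ≠ 0 ∧ 6 * c = 0 := by
  obtain ⟨m, h0, hlt, h6⟩ : ∃ m, 0 < m ∧ m < N ∧ N ∣ 6 * m := by
    rcases hdvd with ⟨m, rfl⟩ | ⟨m, rfl⟩
    · exact ⟨m, by lia, by lia, 3, by ring⟩
    · exact ⟨m, by lia, by lia, 2, by ring⟩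
  refine ⟨m, fun h => ?_, ?_⟩
  · exact Nat.not_dvd_of_pos_of_lt h0 hlt ((ZMod.natCast_eq_zero_iff m N).1 h)
  · exact_mod_cast (ZMod.natCast_eq_zero_iff (6 * m) N).2 h6

/-- On the infinite Kagome lattice (three sublattices `A`, `B`, `C` indexed by `ℤ × ℤ`),
if `N ≥ 2` is divisible by `2` or by `3`, then there exists a finitely supported
`ZMod N`-valued discrete harmonic triple that is not identically zero. -/
theorem kagome_nontrivial_finite_harmonic (N : ℕ) (hN : 2 ≤ N) (hdvd : 2 ∣ N ∨ 3 ∣ N) :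
    ∃ hA hB hC : ℤ × ℤ → ZMod N,
      (Function.support hA).Finite ∧ (Function.support hB).Finite ∧
      (Function.support hC).Finite ∧
      (∀ i j : ℤ,
        4 * hA (i, j) = hC (i, j) + hB (i + 1, j) + hB (i, j - 1) + hC (i, j - 1)) ∧
      (∀ i j : ℤ,
        4 * hB (i, j) = hC (i, j) + hA (i, j + 1) + hA (i - 1, j) + hC (i - 1, j)) ∧
      (∀ i j : ℤ,
        4 * hC (i, j) = hA (i, j) + hB (i + 1, j) + hB (i, j) + hA (i, j + 1)) ∧
      ¬ (hA = 0 ∧ hB = 0 ∧ hC = 0) := by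
  obtain ⟨c, hc, h6⟩ := ZMod.exists_ne_zero_six_mul_eq_zero N hN hdvd
  -- The alternating function `±c` on a single hexagon sums to zero on every triangle,
  -- so its Laplacian is `6` times itself.
  let δ : ℤ × ℤ → ZMod N := Pi.single 0 c
  have hδ6 (v : ℤ × ℤ) : 6 * δ v = 0 := by
    by_cases hv : v = 0 <;> simp [δ, hv, h6]
  have hδ : (Function.support δ).Finite :=
    (Set.finite_singleton 0).subset Pi.support_single_subset
  have hshift (w : ℤ × ℤ) : (Function.support fun v => δ (v + w)).Finite :=
    hδ.preimage (add_left_injective w).injOn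
  refine ⟨fun v => δ v - δ (v + (1, 0)), fun v => δ v - δ (v + (0, 1)),
    fun v => δ (v + (1, 1)) - δ v, ?_, ?_, ?_, fun i j => ?_, fun i j => ?_, fun i j => ?_, ?_⟩
  · exact (hδ.union (hshift _)).subset (Function.support_sub _ _)
  · exact (hδ.union (hshift _)).subset (Function.support_sub _ _)
  · exact ((hshift _).union hδ).subset (Function.support_sub _ _)
  · simp only [Prod.mk_add_mk, add_zero, sub_add_cancel]
    linear_combination hδ6 (i, j) - hδ6 (i + 1, j)
  · simp only [Prod.mk_add_mk, add_zero, sub_add_cancel]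
    linear_combination hδ6 (i, j) - hδ6 (i, j + 1)
  · simp only [Prod.mk_add_mk, add_zero]
    linear_combination hδ6 (i + 1, j + 1) - hδ6 (i, j)
  · rintro ⟨hA, -, -⟩
    exact hc (by simpa [δ, Pi.single_apply] using congrFun hA 0)
end

section
/- Let p be a prime, F the algebraic closure of ZMod p, and f ∈ F[x,y]. Let L_x = p^k_x · L_x' and L_y = p^k_y · L_y' be positive integers with p not dividing L_x' and p not dividing L_y'. Let S = {(a,b) ∈ F × F : f(a,b) = 0, a^L_x = 1, b^L_y = 1} (a finite set). Then the dimension over F of F[x,y] / (f, x^L_x − 1, y^L_y − 1) equals the sum over (a,b) ∈ S of the dimension over F of F[x,y] / (f, (x−a)^(p^k_x), (y−b)^(p^k_y)). -/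
open MvPolynomial

/-- The Chinese remainder theorem, in terms of dimensions. -/
lemma finrank_quotient_prod_eq_sum {K R ι : Type*} [Field K] [CommRing R] [Algebra K R]
    (s : Finset ι) (J : ι → Ideal R) [∀ i, Module.Finite K (R ⧸ J i)]
    (hJ : ∀ i ∈ s, ∀ j ∈ s, i ≠ j → IsCoprime (J i) (J j)) :
    Module.finrank K (R ⧸ ∏ i ∈ s, J i) = ∑ i ∈ s, Module.finrank K (R ⧸ J i) := by
  have hinf : ∏ i ∈ s, J i = ⨅ i : s, J i := by
    rw [Ideal.prod_eq_iInf_of_pairwise_isCoprime fun i hi j hj hij => hJ i hi j hj hij,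
      iInf_subtype]
  have hpair : Pairwise (Function.onFun IsCoprime fun i : s => J i) := fun i j hij =>
    hJ i i.2 j j.2 fun h => hij (Subtype.ext h)
  let e : (R ⧸ ⨅ i : s, J i) ≃ₗ[K] ∀ i : s, R ⧸ J i :=
    { Ideal.quotientInfRingEquivPiQuotient (fun i : s => J i) hpair with
      map_smul' := by
        rintro c ⟨r⟩
        rfl }
  rw [hinf, e.finrank_eq, Module.finrank_pi_fintype,
    Finset.sum_coe_sort s fun i => Module.finrank K (R ⧸ J i)]

lemma Ideal.prod_sup_le {R ι : Type*} [CommRing R] (s : Finset ι) (K : Ideal R)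
    (A : ι → Ideal R) : ∏ i ∈ s, (K ⊔ A i) ≤ K ⊔ ∏ i ∈ s, A i := by
  classical
  induction s using Finset.induction_on with
  | empty => simp
  | insert i s hi ih =>
    rw [Finset.prod_insert hi, Finset.prod_insert hi]
    refine (Ideal.mul_mono_right ih).trans ?_
    rw [Ideal.sup_mul, Ideal.mul_sup (A i)]
    exact sup_le (Ideal.mul_le_left.trans le_sup_left)
      (sup_le_sup_right Ideal.mul_le_right _)

lemma Ideal.span_triple_prod_eq_prod {R ι κ : Type*} [CommRing R] (f : R)
    (s : Finset ι) (t : Finset κ) (u : ι → R) (v : κ → R)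
    (hJ : ∀ i ∈ s ×ˢ t, ∀ j ∈ s ×ˢ t, i ≠ j →
      IsCoprime (Ideal.span {f, u i.1, v i.2}) (Ideal.span {f, u j.1, v j.2})) :
    Ideal.span {f, ∏ i ∈ s, u i, ∏ j ∈ t, v j} =
      ∏ ij ∈ s ×ˢ t, Ideal.span {f, u ij.1, v ij.2} := by
  apply le_antisymm
  · rw [Ideal.prod_eq_iInf_of_pairwise_isCoprime fun i hi j hj hij => hJ i hi j hj hij]
    refine le_iInf₂ fun ij hij => Ideal.span_le.2 ?_
    obtain ⟨hi, hj⟩ := Finset.mem_product.1 hij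
    rintro x (rfl | rfl | rfl)
    · exact Ideal.subset_span (by simp)
    · exact Ideal.mem_of_dvd _ (Finset.dvd_prod_of_mem u hi) (Ideal.subset_span (by simp))
    · exact Ideal.mem_of_dvd _ (Finset.dvd_prod_of_mem v hj) (Ideal.subset_span (by simp))
  · simp only [Ideal.span_insert, ← Ideal.prod_span_singleton, Finset.prod_product, ← sup_assoc]
    calc
      _ ≤ ∏ i ∈ s, (Ideal.span {f} ⊔ Ideal.span {u i} ⊔ ∏ j ∈ t, Ideal.span {v j}) :=
        Finset.prod_le_prod' fun i _ => Ideal.prod_sup_le _ _ _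
      _ = ∏ i ∈ s, (Ideal.span {f} ⊔ (∏ j ∈ t, Ideal.span {v j}) ⊔ Ideal.span {u i}) := by
        simp only [sup_right_comm]
      _ ≤ _ := Ideal.prod_sup_le _ _ _
      _ = _ := sup_right_comm _ _ _

lemma MvPolynomial.isCoprime_X_sub_C {σ K : Type*} [Field K] (i : σ) {a b : K} (hab : a ≠ b) :
    IsCoprime (X i - C a : MvPolynomial σ K) (X i - C b) := by
  refine ⟨-C (a - b)⁻¹, C (a - b)⁻¹, ?_⟩
  have : C (a - b)⁻¹ * (C a - C b) = (1 : MvPolynomial σ K) := by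
    rw [← C_sub, ← C_mul, inv_mul_cancel₀ (sub_ne_zero.2 hab), C_1]
  linear_combination this

lemma Ideal.isCoprime_of_mem {R : Type*} [CommRing R] {I J : Ideal R} {x y : R}
    (hx : x ∈ I) (hy : y ∈ J) (h : IsCoprime x y) : IsCoprime I J := by
  obtain ⟨a, b, hab⟩ := h
  exact Ideal.isCoprime_iff_exists.2 ⟨_, I.mul_mem_left a hx, _, J.mul_mem_left b hy, hab⟩

lemma MvPolynomial.isCoprime_span_pow {K : Type*} [Field K] (f : MvPolynomial (Fin 2) K)
    (m n : ℕ) {P Q : K × K} (hPQ : P ≠ Q) :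
    IsCoprime (Ideal.span {f, (X 0 - C P.1) ^ m, (X 1 - C P.2) ^ n})
      (Ideal.span {f, (X 0 - C Q.1) ^ m, (X 1 - C Q.2) ^ n}) := by
  by_cases h : P.1 = Q.1
  · have h2 : P.2 ≠ Q.2 := fun h2 => hPQ (Prod.ext h h2)
    exact Ideal.isCoprime_of_mem (Ideal.subset_span (by simp)) (Ideal.subset_span (by simp))
      ((isCoprime_X_sub_C (1 : Fin 2) h2).pow (m := n) (n := n))
  · exact Ideal.isCoprime_of_mem (Ideal.subset_span (by simp)) (Ideal.subset_span (by simp))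
      ((isCoprime_X_sub_C (0 : Fin 2) h).pow (m := m) (n := m))

lemma MvPolynomial.finite_quotient_of_pow_mem {σ K : Type*} [Finite σ] [Field K]
    (I : Ideal (MvPolynomial σ K)) (a : σ → K)
    (h : ∀ i, ∃ n, (X i - C (a i)) ^ n ∈ I) :
    Module.Finite K (MvPolynomial σ K ⧸ I) := by
  have hX : ∀ i, IsIntegral K (Ideal.Quotient.mkₐ K I (X i)) := fun i => by
    obtain ⟨n, hn⟩ := h i
    refine ⟨(Polynomial.X - Polynomial.C (a i)) ^ n, (Polynomial.monic_X_sub_C _).pow n, ?_⟩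
    rw [Polynomial.eval₂_pow, Polynomial.eval₂_sub, Polynomial.eval₂_X, Polynomial.eval₂_C]
    exact Ideal.Quotient.eq_zero_iff_mem.2 hn
  have : Algebra.IsIntegral K (MvPolynomial σ K ⧸ I) := ⟨fun x => by
    obtain ⟨q, rfl⟩ := Ideal.Quotient.mkₐ_surjective K I x
    induction q using MvPolynomial.induction_on with
    | C c => exact isIntegral_algebraMap (R := K) (x := c)
    | add q r hq hr => rw [map_add]; exact hq.add hr
    | mul_X q i hq => rw [map_mul]; exact hq.mul (hX i)⟩
  exact Algebra.IsIntegral.finite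

lemma MvPolynomial.eq_top_of_eval_ne_zero {σ K : Type*} [Field K]
    (I : Ideal (MvPolynomial σ K)) (a : σ → K)
    (h : ∀ i, ∃ n, (X i - C (a i)) ^ n ∈ I) {f : MvPolynomial σ K} (hf : f ∈ I)
    (hfa : eval a f ≠ 0) : I = ⊤ := by
  by_contra hI
  obtain ⟨M, hM, hIM⟩ := Ideal.exists_le_maximal I hI
  have hhom : Ideal.Quotient.mk M =
      (Ideal.Quotient.mk M).comp (C.comp (eval a)) := by
    refine MvPolynomial.ringHom_ext (fun c => by simp) fun i => ?_
    obtain ⟨n, hn⟩ := h i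
    have := hM.isPrime.mem_of_pow_mem n (hIM hn)
    simpa using Ideal.Quotient.eq.2 this
  have hmem : C (eval a f) ∈ M := by
    rw [← Ideal.Quotient.eq_zero_iff_mem]
    have := RingHom.congr_fun hhom f
    rw [Ideal.Quotient.eq_zero_iff_mem.2 (hIM hf)] at this
    exact this.symm
  exact hM.ne_top (Ideal.eq_top_of_isUnit_mem _ hmem ((isUnit_iff_ne_zero.2 hfa).map C))

lemma MvPolynomial.X_pow_sub_one_eq_prod_pow {σ K : Type*} [Field K] [IsAlgClosed K]
    (p : ℕ) [Fact p.Prime] [CharP K p] (i : σ) (k n : ℕ) (hn : ¬ p ∣ n) :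
    (X i ^ (p ^ k * n) - 1 : MvPolynomial σ K) =
      ∏ a ∈ Polynomial.nthRootsFinset n (1 : K), (X i - C a) ^ p ^ k := by
  have hnK : NeZero (n : K) := ⟨fun h => hn ((CharP.cast_eq_zero_iff K p n).1 h)⟩
  have hpos : 0 < n := Nat.pos_of_ne_zero fun h => hn (h ▸ dvd_zero p)
  obtain ⟨ζ, hζ⟩ := HasEnoughRootsOfUnity.exists_primitiveRoot K n
  have hprod := congrArg (Polynomial.aeval (X i : MvPolynomial σ K))
    (Polynomial.X_pow_sub_one_eq_prod hpos hζ)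
  simp only [map_sub, map_pow, map_prod, Polynomial.aeval_X, Polynomial.aeval_C, map_one,
    MvPolynomial.algebraMap_eq] at hprod
  rw [Finset.prod_pow, ← hprod, sub_pow_char_pow, one_pow, ← pow_mul, mul_comm]

/-- Localization formula for the dimension of `F[x,y]/(f, x^Lx - 1, y^Ly - 1)` over the
algebraic closure `F` of `ZMod p`: writing `Lx = p^kx · Lx'` and `Ly = p^ky · Ly'` with
`p ∤ Lx'`, `p ∤ Ly'`, the dimension equals the sum, over common roots `(a,b)` of
`f`, `x^Lx - 1`, `y^Ly - 1` in `F × F`, of the dimension of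
`F[x,y]/(f, (x-a)^(p^kx), (y-b)^(p^ky))`. -/
theorem dim_quotient_eq_sum_localizations (p : ℕ) [Fact p.Prime]
    (f : MvPolynomial (Fin 2) (AlgebraicClosure (ZMod p)))
    (kx ky Lx' Ly' : ℕ) (hLx' : ¬ p ∣ Lx') (hLy' : ¬ p ∣ Ly') :
    Module.finrank (AlgebraicClosure (ZMod p))
      (MvPolynomial (Fin 2) (AlgebraicClosure (ZMod p)) ⧸
        Ideal.span {f, X 0 ^ (p ^ kx * Lx') - 1, X 1 ^ (p ^ ky * Ly') - 1}) =
      ∑ᶠ ab ∈ {ab : AlgebraicClosure (ZMod p) × AlgebraicClosure (ZMod p) |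
          MvPolynomial.eval ![ab.1, ab.2] f = 0 ∧
            ab.1 ^ (p ^ kx * Lx') = 1 ∧ ab.2 ^ (p ^ ky * Ly') = 1},
        Module.finrank (AlgebraicClosure (ZMod p))
          (MvPolynomial (Fin 2) (AlgebraicClosure (ZMod p)) ⧸
            Ideal.span {f, (X 0 - C ab.1) ^ p ^ kx, (X 1 - C ab.2) ^ p ^ ky}) := by
  set K := AlgebraicClosure (ZMod p)
  have hCharP : CharP K p := charP_of_injective_algebraMap (algebraMap (ZMod p) K).injective p
  have hroots (k n : ℕ) (hn : ¬ p ∣ n) (a : K) :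
      a ^ (p ^ k * n) = 1 ↔ a ∈ Polynomial.nthRootsFinset n (1 : K) := by
    rw [ExpChar.pow_prime_pow_mul_eq_one_iff, Polynomial.mem_nthRootsFinset
      (Nat.pos_of_ne_zero (n := n) fun h => hn (h ▸ dvd_zero p))]
  let J (P : K × K) : Ideal (MvPolynomial (Fin 2) K) :=
    Ideal.span {f, (X 0 - C P.1) ^ p ^ kx, (X 1 - C P.2) ^ p ^ ky}
  have hpow (P : K × K) (i : Fin 2) : ∃ n, (X i - C (![P.1, P.2] i)) ^ n ∈ J P := by
    fin_cases i
    · exact ⟨p ^ kx, Ideal.subset_span (by simp)⟩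
    · exact ⟨p ^ ky, Ideal.subset_span (by simp)⟩
  have hfin (P : K × K) : Module.Finite K (MvPolynomial (Fin 2) K ⧸ J P) :=
    finite_quotient_of_pow_mem _ _ (hpow P)
  rw [X_pow_sub_one_eq_prod_pow p 0 kx Lx' hLx', X_pow_sub_one_eq_prod_pow p 1 ky Ly' hLy',
    Ideal.span_triple_prod_eq_prod f _ _ (fun a => (X 0 - C a) ^ p ^ kx)
      (fun b => (X 1 - C b) ^ p ^ ky) fun P _ Q _ => isCoprime_span_pow f _ _]
  refine (finrank_quotient_prod_eq_sum (K := K) _ J fun P _ Q _ =>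
    isCoprime_span_pow f _ _).trans ?_
  symm
  apply finsum_mem_eq_sum_of_inter_support_eq
  ext P
  simp only [Set.mem_inter_iff, Set.mem_ofPred_eq, Function.mem_support, Finset.mem_coe,
    Finset.mem_product, hroots kx Lx' hLx', hroots ky Ly' hLy']
  refine ⟨fun h => ⟨h.1.2, h.2⟩, fun h => ⟨⟨?_, h.1⟩, h.2⟩⟩
  by_contra hf
  have htop : J P = ⊤ :=
    eq_top_of_eval_ne_zero _ _ (hpow P) (Ideal.subset_span (by simp)) hf
  have : Subsingleton (MvPolynomial (Fin 2) K ⧸ J P) := Ideal.Quotient.subsingleton_iff.2 htop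
  exact h.2 (Module.finrank_zero_of_subsingleton (R := K) (M := MvPolynomial (Fin 2) K ⧸ J P))
end

section
/- In the polynomial ring (ZMod 3)[x,y], for all nonnegative integers a, b, c, d with (a,b) ≠ (c,d), the polynomial x + y + x·y does not divide x^a·y^b − x^c·y^d. -/
open MvPolynomial

/-- Over a field, products of powers of `X` and `-1 - X` have unique exponents. -/
theorem Polynomial.X_pow_mul_neg_one_sub_X_pow_inj {K : Type*} [Field K] {a b c d : ℕ}
    (h : (Polynomial.X ^ a * (-1 - Polynomial.X) ^ b : Polynomial K) =
      Polynomial.X ^ c * (-1 - Polynomial.X) ^ d) : a = c ∧ b = d := by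
  have hdeg : (-1 - Polynomial.X : Polynomial K).natDegree = 1 := by
    rw [show (-1 - Polynomial.X : Polynomial K) = -(Polynomial.X + Polynomial.C 1) by
      rw [map_one]; ring, Polynomial.natDegree_neg, Polynomial.natDegree_X_add_C]
  have hne : (-1 - Polynomial.X : Polynomial K) ≠ 0 := by
    intro h0
    simp [h0] at hdeg
  have htrail (n : ℕ) : ((-1 - Polynomial.X) ^ n : Polynomial K).natTrailingDegree = 0 :=
    Polynomial.natTrailingDegree_eq_zero.2 (Or.inr (by simp [Polynomial.coeff_zero_eq_eval_zero]))
  have hd := congrArg Polynomial.natDegree h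
  have ht := congrArg Polynomial.natTrailingDegree h
  have hX (n : ℕ) : (Polynomial.X ^ n : Polynomial K) ≠ 0 := pow_ne_zero _ Polynomial.X_ne_zero
  rw [Polynomial.natDegree_mul (hX a) (pow_ne_zero _ hne),
    Polynomial.natDegree_mul (hX c) (pow_ne_zero _ hne)] at hd
  rw [Polynomial.natTrailingDegree_mul (hX a) (pow_ne_zero _ hne),
    Polynomial.natTrailingDegree_mul (hX c) (pow_ne_zero _ hne)] at ht
  simp only [Polynomial.natDegree_pow, Polynomial.natDegree_X, hdeg] at hd
  simp only [Polynomial.natTrailingDegree_X_pow, htrail] at ht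
  omega

/-- In `(ZMod 3)[x,y]`, for nonnegative integers `a, b, c, d` with `(a,b) ≠ (c,d)`, the
polynomial `x + y + x·y` does not divide `x^a·y^b - x^c·y^d`. -/
theorem second_factor_lineon_immobile (a b c d : ℕ) (h : (a, b) ≠ (c, d)) :
    ¬ ((X 0 + X 1 + X 0 * X 1 : MvPolynomial (Fin 2) (ZMod 3)) ∣
        X 0 ^ a * X 1 ^ b - X 0 ^ c * X 1 ^ d) := by
  intro hdvd
  -- The curve `x + y + x * y = 0` is parametrized by `x = 1 / t`, `y = 1 / (-1 - t)`.
  let ι := algebraMap (Polynomial (ZMod 3)) (FractionRing (Polynomial (ZMod 3)))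
  have hι : Function.Injective ι := IsFractionRing.injective _ _
  have hs : (-1 - Polynomial.X : Polynomial (ZMod 3)) ≠ 0 := by
    intro h0
    simpa using congrArg (Polynomial.eval 0) h0
  have hx : ι Polynomial.X ≠ 0 := (map_ne_zero_iff ι hι).2 Polynomial.X_ne_zero
  have hy : ι (-1 - Polynomial.X) ≠ 0 := (map_ne_zero_iff ι hι).2 hs
  have hmap := map_dvd
    (aeval (R := ZMod 3) ![(ι Polynomial.X)⁻¹, (ι (-1 - Polynomial.X))⁻¹]) hdvd
  have hzero : (ι Polynomial.X)⁻¹ + (ι (-1 - Polynomial.X))⁻¹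
      + (ι Polynomial.X)⁻¹ * (ι (-1 - Polynomial.X))⁻¹ = 0 := by
    field_simp
    simp
  simp only [map_add, map_sub, map_mul, map_pow, aeval_X, Matrix.cons_val_zero,
    Matrix.cons_val_one] at hmap
  simp only [map_sub, map_neg, map_one] at hzero hmap
  rw [hzero, zero_dvd_iff, sub_eq_zero, ← inv_inj] at hmap
  simp only [mul_inv, inv_pow, inv_inv] at hmap
  obtain ⟨hac, hbd⟩ := Polynomial.X_pow_mul_neg_one_sub_X_pow_inj
    (hι (by simpa using hmap))
  exact h (by rw [hac, hbd])
end

section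
/- Let p be an odd prime, q an odd prime distinct from p, and m ≥ 0 an integer such that, if m ≥ 1, then p is a primitive root modulo q^m. Let k_x, k_y be nonnegative integers, and set L_x = p^k_x · q^m and L_y = p^k_y · q^m. Then the dimension over ZMod p of (ZMod p)[x,y] / (f, x^L_x − 1, y^L_y − 1) equals 2 · p^(min(k_x,k_y)) − 1 if k_x = k_y, and 2 · p^(min(k_x,k_y)) if k_x ≠ k_y, where f(x,y) = x·(y−1)^2 + y·(x−1)^2. -/
open MvPolynomial

theorem exists_pow_modEq_of_orderOf_eq_totient {p N : ℕ} [NeZero N] (hco : p.Coprime N)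
    (hord : orderOf (p : ZMod N) = N.totient) {j : ℕ} (hj : j.Coprime N) :
    ∃ k, p ^ k ≡ j [MOD N] := by
  have hcard : orderOf (ZMod.unitOfCoprime p hco) = Nat.card (ZMod N)ˣ := by
    rw [← orderOf_units, ZMod.coe_unitOfCoprime, hord, Nat.card_eq_fintype_card,
      ZMod.card_units_eq_totient]
  have htop : Subgroup.zpowers (ZMod.unitOfCoprime p hco) = ⊤ :=
    Subgroup.eq_top_of_card_eq _ (by rw [Nat.card_zpowers, hcard])
  obtain ⟨k, hk⟩ := mem_powers_iff_mem_zpowers.2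
    (htop ▸ Subgroup.mem_top (ZMod.unitOfCoprime j hj))
  refine ⟨k, (ZMod.natCast_eq_natCast_iff _ _ _).1 ?_⟩
  simpa using congrArg Units.val hk

theorem sum_range_pow_eq_ite {K : Type*} [Field K] {N : ℕ} {t : K} [Decidable (t = 1)]
    (ht : t ^ N = 1) :
    ∑ j ∈ Finset.range N, t ^ j = (N : K) * if t = 1 then 1 else 0 := by
  split_ifs with h
  · simp [h]
  · rw [geom_sum_eq h, ht, sub_self, zero_div, mul_zero]

theorem eq_one_of_pow_coprime {K : Type*} [Monoid K] {x : K} {a b : ℕ} (hab : a.Coprime b)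
    (ha : x ^ a = 1) (hb : x ^ b = 1) : x = 1 := by
  simpa [hab.gcd_eq_one] using pow_gcd_eq_one.2 ⟨ha, hb⟩

/-- The Laplacian relation is stable under Galois conjugation `(x, y) ↦ (x ^ j, y ^ j)`. -/
theorem laplacian_conj {K : Type*} [Field K] {p N : ℕ} [Fact p.Prime] [CharP K p] [NeZero N]
    (hco : p.Coprime N) (hord : orderOf (p : ZMod N) = N.totient) {x y : K}
    (hx : x ^ N = 1) (hy : y ^ N = 1) (h : x + x⁻¹ + y + y⁻¹ = 4) {j : ℕ} (hj : j.Coprime N) :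
    x ^ j + x⁻¹ ^ j + y ^ j + y⁻¹ ^ j = 4 := by
  obtain ⟨k, hk⟩ := exists_pow_modEq_of_orderOf_eq_totient hco hord hj
  have key : ∀ {t : K}, t ^ N = 1 → t ^ j = t ^ p ^ k := fun {t} ht => by
    rw [pow_eq_pow_mod j ht, pow_eq_pow_mod (p ^ k) ht, hk]
  have h4 : (4 : K) ^ p ^ k = 4 := by
    have := map_ofNat (iterateFrobenius K p k) 4
    rwa [iterateFrobenius_def] at this
  rw [key hx, key hy, key (by rw [inv_pow, hx, inv_one]), key (by rw [inv_pow, hy, inv_one]),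
    ← add_pow_char_pow, ← add_pow_char_pow, ← add_pow_char_pow, h, h4]

open Classical in
/-- The exponent multiplicities of the Laplacian relation are invariant under translation by
`q`-th roots of unity. -/
theorem laplacian_multiplicity_periodic {K : Type*} [Field K] {p q m : ℕ} [Fact p.Prime]
    [CharP K p] (hq : q.Prime) (hco : p.Coprime (q ^ m)) (hm : m ≠ 0)
    (hord : orderOf (p : ZMod (q ^ m)) = (q ^ m).totient) {x y : K}
    (hx : x ^ q ^ m = 1) (hy : y ^ q ^ m = 1) (h : x + x⁻¹ + y + y⁻¹ = 4)
    {w : K} (hw : w ^ q = 1) :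
    (if x * w = 1 then 1 else 0) + (if x⁻¹ * w = 1 then 1 else 0)
      + (if y * w = 1 then 1 else 0) + (if y⁻¹ * w = 1 then 1 else 0)
      - 4 * (if w = 1 then 1 else 0 : K) =
    (if x = 1 then 1 else 0) + (if x⁻¹ = 1 then 1 else 0)
      + (if y = 1 then 1 else 0) + (if y⁻¹ = 1 then 1 else 0) - 4 := by
  have : NeZero (q ^ m) := ⟨pow_ne_zero _ hq.ne_zero⟩
  have hwN : w ^ q ^ m = 1 := by
    obtain ⟨k, rfl⟩ := Nat.exists_eq_succ_of_ne_zero hm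
    rw [pow_succ', pow_mul, hw, one_pow]
  have hxi : x⁻¹ ^ q ^ m = 1 := by rw [inv_pow, hx, inv_one]
  have hyi : y⁻¹ ^ q ^ m = 1 := by rw [inv_pow, hy, inv_one]
  have hmul : ∀ {t : K}, t ^ q ^ m = 1 → (t * w) ^ q ^ m = 1 := fun {t} ht => by
    rw [mul_pow, ht, hwN, one_mul]
  have hN : ((q ^ m : ℕ) : K) ≠ 0 := by
    rw [Ne, CharP.cast_eq_zero_iff K p]
    exact fun hd => (Fact.out : p.Prime).one_lt.ne' (Nat.eq_one_of_dvd_coprimes hco dvd_rfl hd)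
  have hterm : ∀ j, ((x * w) ^ j + (x⁻¹ * w) ^ j + (y * w) ^ j + (y⁻¹ * w) ^ j - 4 * w ^ j)
      - (x ^ j + x⁻¹ ^ j + y ^ j + y⁻¹ ^ j - 4 * 1 ^ j) = 0 := by
    intro j
    by_cases hj : q ∣ j
    · obtain ⟨k, rfl⟩ := hj
      have : w ^ (q * k) = 1 := by rw [pow_mul, hw, one_pow]
      simp only [mul_pow, this, one_pow]
      ring
    · have := laplacian_conj hco hord hx hy h (j := j)
        (Nat.Coprime.pow_right _ ((Nat.Prime.coprime_iff_not_dvd hq).2 hj).symm)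
      simp only [mul_pow, one_pow]
      linear_combination (w ^ j - 1) * this
  have hsum := Finset.sum_eq_zero (s := Finset.range (q ^ m)) fun j _ => hterm j
  simp only [Finset.sum_sub_distrib, Finset.sum_add_distrib, ← Finset.mul_sum] at hsum
  rw [sum_range_pow_eq_ite hwN, sum_range_pow_eq_ite hx, sum_range_pow_eq_ite hxi,
    sum_range_pow_eq_ite hy, sum_range_pow_eq_ite hyi, sum_range_pow_eq_ite (hmul hx),
    sum_range_pow_eq_ite (hmul hxi), sum_range_pow_eq_ite (hmul hy),
    sum_range_pow_eq_ite (hmul hyi), sum_range_pow_eq_ite (one_pow _)] at hsum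
  apply mul_left_cancel₀ hN
  rw [if_pos rfl] at hsum
  linear_combination hsum

theorem eq_one_of_add_inv_eq_two {K : Type*} [Field K] {y : K} (hy : y ≠ 0)
    (h : y + y⁻¹ = 2) : y = 1 := by
  have : (y - 1) ^ 2 = 0 := by
    field_simp at h
    linear_combination h
  exact sub_eq_zero.1 (pow_eq_zero_iff two_ne_zero |>.1 this)

theorem add_inv_eq_four_of_laplacian {K : Type*} [Field K] {x y : K} (hx : x ≠ 0) (hy : y ≠ 0)
    (h : x * (y - 1) ^ 2 + y * (x - 1) ^ 2 = 0) : x + x⁻¹ + y + y⁻¹ = 4 := by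
  field_simp
  linear_combination h

/-- Over a field of characteristic `p` that contains the `q`-th roots of unity, the only zero of
the Laplacian relation among the `q ^ m`-th roots of unity is `(1, 1)`. -/
theorem eq_one_of_laplacian {K : Type*} [Field K] {p q m : ℕ} [Fact p.Prime]
    [CharP K p] (hpodd : Odd p) (hq : q.Prime) (hqodd : Odd q) (hqp : q ≠ p)
    (hm : m ≠ 0) (hord : orderOf (p : ZMod (q ^ m)) = (q ^ m).totient)
    {ω : K} (hω : IsPrimitiveRoot ω q) {x y : K}
    (hx : x ^ q ^ m = 1) (hy : y ^ q ^ m = 1) (h : x + x⁻¹ + y + y⁻¹ = 4) : x = 1 := by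
  classical
  have hp : p.Prime := Fact.out
  have hco : p.Coprime (q ^ m) := .pow_right _ ((Nat.coprime_primes hp hq).2 hqp.symm)
  have h2' : (2 : K) ≠ 0 := by
    have := (CharP.cast_eq_zero_iff K p 2).not.2 fun h =>
      absurd ((Nat.prime_dvd_prime_iff_eq hp Nat.prime_two).1 h ▸ hpodd) (by decide)
    exact_mod_cast this
  have hN0 : q ^ m ≠ 0 := pow_ne_zero _ hq.ne_zero
  have hx0 : x ≠ 0 := by rintro rfl; exact zero_ne_one ((zero_pow hN0).symm.trans hx)
  have hy0 : y ≠ 0 := by rintro rfl; exact zero_ne_one ((zero_pow hN0).symm.trans hy)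
  have hNodd : Odd (q ^ m) := hqodd.pow
  have tors2 : ∀ {t : K}, t ^ q ^ m = 1 → t ^ 4 = 1 → t = 1 := fun ht h4 =>
    eq_one_of_pow_coprime (b := 4) (hNodd.coprime_two_right.pow_right 2) ht h4
  by_contra hx1
  have hy1 : y ≠ 1 := by
    rintro rfl
    exact hx1 (eq_one_of_add_inv_eq_two hx0 (by rw [inv_one] at h; linear_combination h))
  have hxy : x ≠ y := by
    rintro rfl
    exact hx1 (eq_one_of_add_inv_eq_two hx0 (mul_left_cancel₀ h2' (by linear_combination h)))
  have hxy' : x * y ≠ 1 := fun hm => by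
    rw [← eq_inv_of_mul_eq_one_right hm, ← eq_inv_of_mul_eq_one_left hm] at h
    exact hx1 (eq_one_of_add_inv_eq_two hx0 (mul_left_cancel₀ h2' (by
      rw [← eq_inv_of_mul_eq_one_right hm]; linear_combination h)))
  have tors1 : ∀ {t : K}, t ^ q ^ m = 1 → t * t = 1 → t = 1 := fun {t} ht h2 =>
    tors2 ht (by linear_combination (t * t + 1) * h2)
  have hmem : ∀ {w : K}, w ^ q = 1 → w ≠ 1 →
      (w = x ∨ x * w = 1 ∨ w = y ∨ y * w = 1) ∧ (5 : K) = 0 := by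
    intro w hw hw1
    have hper := laplacian_multiplicity_periodic hq hco hm hord hx hy h hw
    simp only [inv_mul_eq_one₀ hx0, inv_mul_eq_one₀ hy0, inv_eq_one, hx1, hy1, hw1,
      if_false] at hper
    have e12 : x * w = 1 → x ≠ w := fun h1 h2 => hx1 (tors1 hx (h2 ▸ h1))
    have e34 : y * w = 1 → y ≠ w := fun h1 h2 => hy1 (tors1 hy (h2 ▸ h1))
    have e13 : x * w = 1 → y * w ≠ 1 := fun h1 h2 =>
      hxy (by linear_combination (-x) * h2 + y * h1)
    have e14 : x * w = 1 → y ≠ w := fun h1 h2 => hxy' (h2 ▸ h1)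
    have e23 : y * w = 1 → x ≠ w := fun h1 h2 => hxy' (by rw [mul_comm, h2, h1])
    have e24 : x = w → y ≠ w := fun h1 h2 => hxy (h1.trans h2.symm)
    by_cases h1 : x * w = 1
    · simp only [h1, e12 h1, e13 h1, e14 h1, if_true, if_false] at hper
      exact ⟨.inr (.inl h1), by linear_combination hper⟩
    by_cases h3 : y * w = 1
    · simp only [h1, h3, e23 h3, e34 h3, if_true, if_false] at hper
      exact ⟨.inr (.inr (.inr h3)), by linear_combination hper⟩
    by_cases h2 : x = w
    · simp only [h1, h3, e24 h2, if_pos h2, if_false] at hper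
      exact ⟨.inl h2.symm, by linear_combination hper⟩
    by_cases h4 : y = w
    · simp only [h1, h3, h2, if_pos h4, if_false] at hper
      exact ⟨.inr (.inr (.inl h4.symm)), by linear_combination hper⟩
    simp only [h1, h2, h3, h4, if_false] at hper
    exact absurd ((pow_eq_zero_iff two_ne_zero).1 (by linear_combination hper)) h2'
  have h5 : (5 : K) = 0 := (hmem hω.pow_eq_one (hω.ne_one hq.one_lt)).2
  have hq5 : q ≠ 5 := by
    rintro rfl
    refine hqp (((Nat.prime_dvd_prime_iff_eq hp (by norm_num)).1 ?_).symm)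
    exact (CharP.cast_eq_zero_iff K p 5).1 (by exact_mod_cast h5)
  have key : ∀ {a b : K}, a ^ q ^ m = 1 → b ^ q ^ m = 1 → a ≠ 1 → b ≠ 1 → a ≠ 0 → b ≠ 0 →
      a + a⁻¹ + b + b⁻¹ = 4 → (∀ {w : K}, w ^ q = 1 → w ≠ 1 →
        w = a ∨ a * w = 1 ∨ w = b ∨ b * w = 1) → a ^ q ≠ 1 := by
    intro a b haN hbN ha1 hb1 ha0 hb0 hab hmem' haq
    have ha2 : a * a ≠ 1 := fun h => ha1 (tors1 haN h)
    have ha3 : a ^ 3 ≠ 1 := by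
      intro ha3
      have hsum : a ^ 2 + a + 1 = 0 :=
        mul_left_cancel₀ (sub_ne_zero.2 ha1) (by linear_combination ha3)
      have hinv : a⁻¹ = a ^ 2 := inv_eq_of_mul_eq_one_right (by linear_combination ha3)
      have hb : b + b⁻¹ = 0 := by linear_combination hab - hsum + h5 - hinv
      have hbb : b * b = -1 := by
        have := mul_inv_cancel₀ hb0
        linear_combination b * hb - this
      exact hb1 (tors2 hbN (by linear_combination (b * b - 1) * hbb))
    have ha4 : a ^ 4 ≠ 1 := fun h => ha1 (tors2 haN h)
    have ha5 : a ^ 5 ≠ 1 := fun h =>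
      ha1 (eq_one_of_pow_coprime ((Nat.coprime_primes hq (by norm_num)).2 hq5) haq h)
    have hpow : ∀ k, (a ^ k) ^ q = 1 := fun k => by rw [pow_right_comm, haq, one_pow]
    have hcancel : ∀ {c d : K}, a * c = a * d → c = d := fun h => mul_left_cancel₀ ha0 h
    have hb : a ^ 2 = b ∨ b * a ^ 2 = 1 := by
      rcases hmem' (hpow 2) (by rwa [pow_two]) with h | h | h | h
      · exact absurd (hcancel (by linear_combination h)) ha1
      · exact absurd (by linear_combination h) ha3
      · exact .inl h
      · exact .inr h
    rcases hmem' (hpow 3) ha3 with h | h | h | h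
    · exact ha2 (hcancel (by linear_combination h))
    · exact ha4 (by linear_combination h)
    · rcases hb with hb | hb
      · exact ha1 (hcancel (hcancel (by linear_combination h - hb)))
      · exact ha5 (by rw [← hb, ← h]; ring)
    · rcases hb with hb | hb
      · exact ha5 (by rw [← h, ← hb]; ring)
      · exact ha1 (by linear_combination h - a * hb)
  have hω' := (hmem hω.pow_eq_one (hω.ne_one hq.one_lt)).1
  have hnx := key hx hy hx1 hy1 hx0 hy0 h fun hw hw1 => (hmem hw hw1).1
  have hny := key hy hx hy1 hx1 hy0 hx0 (by linear_combination h) fun hw hw1 => by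
    rcases (hmem hw hw1).1 with h | h | h | h <;> simp [h]
  rcases hω' with h | h | h | h
  · exact hnx (h ▸ hω.pow_eq_one)
  · exact hnx (by simpa [mul_pow, hω.pow_eq_one] using congrArg (· ^ q) h)
  · exact hny (h ▸ hω.pow_eq_one)
  · exact hny (by simpa [mul_pow, hω.pow_eq_one] using congrArg (· ^ q) h)

/-- The square-lattice Laplacian polynomial modulo a power of `x - 1` defines a free quadratic
extension of the truncated polynomial ring, with basis `1, y - 1`. -/
theorem finrank_quotient_laplacian_pow {k : Type*} [Field k] {A : ℕ} (hA : A ≠ 0) :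
    Module.finrank k (MvPolynomial (Fin 2) k ⧸
      Ideal.span {(X 0 * (X 1 - 1) ^ 2 + X 1 * (X 0 - 1) ^ 2 : MvPolynomial (Fin 2) k),
        (X 0 - 1) ^ A}) = 2 * A ∧
    (X 0 - 1) ^ (A - 1) * (X 1 - 1) ∉
      Ideal.span {(X 0 * (X 1 - 1) ^ 2 + X 1 * (X 0 - 1) ^ 2 : MvPolynomial (Fin 2) k),
        (X 0 - 1) ^ A} := by
  set I := Ideal.span {(X 0 * (X 1 - 1) ^ 2 + X 1 * (X 0 - 1) ^ 2 : MvPolynomial (Fin 2) k),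
        (X 0 - 1) ^ A} with hI
  let r : Polynomial k := Polynomial.X ^ A
  have hr : r.Monic := Polynomial.monic_X_pow A
  let S := AdjoinRoot r
  let u : S := AdjoinRoot.root r
  have hu : u ^ A = 0 := by simpa [r] using AdjoinRoot.eval₂_root r
  have hu' : u ^ (A - 1) ≠ 0 := by
    have : AdjoinRoot.mk r (Polynomial.X ^ (A - 1)) ≠ 0 :=
      AdjoinRoot.mk_ne_zero_of_natDegree_lt hr (by simp) (by simp [r]; omega)
    simpa [u] using this
  obtain ⟨i, hi⟩ : ∃ i : S, (1 + u) * i = 1 :=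
    (IsNilpotent.isUnit_one_add ⟨A, hu⟩).exists_right_inv
  obtain ⟨c, hc⟩ : ∃ c : S, (1 + u) * c = u ^ 2 := ⟨u ^ 2 * i, by linear_combination u ^ 2 * hi⟩
  let g : Polynomial S := Polynomial.X ^ 2 + Polynomial.C c * Polynomial.X + Polynomial.C c
  have : Nontrivial S := ⟨_, _, hu'⟩
  have hgd : g.natDegree = 2 := by simp only [g]; compute_degree!
  have hg : g.Monic := by simp only [g]; monicity!
  let T := AdjoinRoot g
  let v : T := AdjoinRoot.root g
  have hv : v ^ 2 + algebraMap S T c * v + algebraMap S T c = 0 := by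
    have h := AdjoinRoot.eval₂_root g
    simp only [g, Polynomial.eval₂_add, Polynomial.eval₂_mul, Polynomial.eval₂_pow,
      Polynomial.eval₂_X, Polynomial.eval₂_C] at h
    exact h
  let φ : MvPolynomial (Fin 2) k →ₐ[k] T := aeval ![1 + algebraMap S T u, 1 + v]
  have hφ0 : φ (X 0) = 1 + algebraMap S T u := by simp [φ]
  have hφ1 : φ (X 1) = 1 + v := by simp [φ]
  have hcT : (1 + algebraMap S T u) * algebraMap S T c = algebraMap S T u ^ 2 := by
    simpa using congrArg (algebraMap S T) hc
  have hφ : I ≤ RingHom.ker φ := by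
    rw [hI, Ideal.span_le, Set.insert_subset_iff, Set.singleton_subset_iff]
    constructor
    · simp only [SetLike.mem_coe, RingHom.mem_ker, map_add, map_mul, map_pow, map_sub, map_one,
        hφ0, hφ1]
      linear_combination (1 + algebraMap S T u) * hv - (v + 1) * hcT
    · simp only [SetLike.mem_coe, RingHom.mem_ker, map_pow, map_sub, map_one, hφ0,
        add_sub_cancel_left]
      rw [← map_pow, hu, map_zero]
  let Φ : (MvPolynomial (Fin 2) k ⧸ I) →ₐ[k] T := Ideal.Quotient.liftₐ I φ hφ
  let x : MvPolynomial (Fin 2) k ⧸ I := Ideal.Quotient.mk I (X 0)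
  let y : MvPolynomial (Fin 2) k ⧸ I := Ideal.Quotient.mk I (X 1)
  have hΦx : Φ x = 1 + algebraMap S T u := hφ0
  have hΦy : Φ y = 1 + v := hφ1
  have hf : x * (y - 1) ^ 2 + y * (x - 1) ^ 2 = 0 :=
    Ideal.Quotient.eq_zero_iff_mem.2 (Ideal.subset_span (by simp))
  have hxA : (x - 1) ^ A = 0 :=
    Ideal.Quotient.eq_zero_iff_mem.2 (Ideal.subset_span (by simp))
  let ψ : S →ₐ[k] (MvPolynomial (Fin 2) k ⧸ I) :=
    AdjoinRoot.liftAlgHom r (Algebra.ofId k _) (x - 1) (by simp [r, hxA])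
  have hψu : ψ u = x - 1 := AdjoinRoot.liftAlgHom_root ..
  have hψi : x * ψ i = 1 := by
    have := congrArg ψ hi
    simpa [hψu] using this
  have hψc : x * ψ c = (x - 1) ^ 2 := by
    have := congrArg ψ hc
    simpa [hψu] using this
  let Ψ : T →ₐ[k] (MvPolynomial (Fin 2) k ⧸ I) :=
    AdjoinRoot.liftAlgHom g ψ (y - 1) (by
      have : (y - 1) ^ 2 + ψ c * (y - 1) + ψ c = 0 := by
        linear_combination ψ i * hf - ((y - 1) ^ 2 + ψ c * y) * hψi + ψ i * y * hψc
      simpa [g] using this)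
  have hΨu : Ψ (algebraMap S T u) = x - 1 := by
    rw [← hψu]; simp [Ψ, T]
  have hΨv : Ψ v = y - 1 := AdjoinRoot.liftAlgHom_root ..
  let e : (MvPolynomial (Fin 2) k ⧸ I) ≃ₐ[k] T := AlgEquiv.ofAlgHom Φ Ψ
    (by
      apply AdjoinRoot.algHom_ext'
      · apply AdjoinRoot.algHom_ext
        change Φ (Ψ (algebraMap S T u)) = algebraMap S T u
        simp [hΨu, hΦx]
      · change Φ (Ψ v) = v
        simp [hΨv, hΦy])
    (by
      apply Ideal.Quotient.algHom_ext
      apply MvPolynomial.algHom_ext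
      intro j
      fin_cases j
      · change Ψ (Φ x) = x
        simp [hΨu, hΦx]
      · change Ψ (Φ y) = y
        simp [hΨv, hΦy])
  constructor
  · have : Module.Free S T := hg.free_adjoinRoot
    have hS : Module.finrank k S = A := by
      rw [(AdjoinRoot.powerBasis' hr).finrank, AdjoinRoot.powerBasis'_dim]
      simp [r]
    have hT : Module.finrank S T = 2 := by
      rw [(AdjoinRoot.powerBasis' hg).finrank, AdjoinRoot.powerBasis'_dim, hgd]
    rw [e.toLinearEquiv.finrank_eq, ← Module.finrank_mul_finrank k S T, hS, hT, mul_comm]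
  · intro hmem
    have h0 := hφ hmem
    simp only [RingHom.mem_ker, map_mul, map_pow, map_sub, map_one, hφ0, hφ1,
      add_sub_cancel_left] at h0
    have : AdjoinRoot.mk g (Polynomial.C (u ^ (A - 1)) * Polynomial.X) ≠ 0 :=
      AdjoinRoot.mk_ne_zero_of_natDegree_lt hg
        (by
          intro h
          have := congrArg (Polynomial.coeff · 1) h
          exact hu' (by simpa [-map_pow] using this))
        (by
          rw [hgd]
          exact (Polynomial.natDegree_C_mul_le _ _).trans_lt (by simp))
    apply this
    rw [map_mul, AdjoinRoot.mk_X, AdjoinRoot.mk_C, map_pow]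
    exact h0

theorem laplacian_pow_two_mul {R : Type*} [CommRing R] {x y i : R} (hi : x * i = 1)
    (hf : x * (y - 1) ^ 2 + y * (x - 1) ^ 2 = 0) (n : ℕ) :
    (y - 1) ^ (2 * n) = (x - 1) ^ (2 * n) * (-(y * i)) ^ n := by
  rw [pow_mul, pow_mul, ← mul_pow]
  congr 1
  linear_combination i * hf - (y - 1) ^ 2 * hi

theorem laplacian_pow_eq_zero {R : Type*} [CommRing R] {x y : R} {A B : ℕ} (hB : Odd B)
    (hAB : A < B) (hf : x * (y - 1) ^ 2 + y * (x - 1) ^ 2 = 0) (hx : (x - 1) ^ A = 0) :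
    (y - 1) ^ B = 0 := by
  obtain ⟨i, hi⟩ : ∃ i, x * i = 1 := by
    have := IsNilpotent.isUnit_one_add (r := x - 1) ⟨A, hx⟩
    rw [add_sub_cancel] at this
    exact this.exists_right_inv
  obtain ⟨n, rfl⟩ := hB
  rw [pow_succ, laplacian_pow_two_mul hi hf, pow_eq_zero_of_le (by omega) hx, zero_mul, zero_mul]

theorem laplacian_pow_self {R : Type*} [CommRing R] {x y : R} {n : ℕ}
    (hf : x * (y - 1) ^ 2 + y * (x - 1) ^ 2 = 0) (hx : (x - 1) ^ (2 * n + 1) = 0) :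
    (y - 1) ^ (2 * n + 1) = (-1) ^ n * ((x - 1) ^ (2 * n) * (y - 1)) ∧
      x * (y - 1) ^ (2 * n + 1) = (y - 1) ^ (2 * n + 1) ∧
      y * (y - 1) ^ (2 * n + 1) = (y - 1) ^ (2 * n + 1) := by
  obtain ⟨i, hi⟩ : ∃ i, x * i = 1 := by
    have := IsNilpotent.isUnit_one_add (r := x - 1) ⟨_, hx⟩
    rw [add_sub_cancel] at this
    exact this.exists_right_inv
  have hxw : x * ((x - 1) ^ (2 * n) * (y - 1)) = (x - 1) ^ (2 * n) * (y - 1) := by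
    linear_combination (y - 1) * hx
  have hsq : (y - 1) ^ 2 = (x - 1) ^ 2 * -(y * i) := by
    simpa using laplacian_pow_two_mul hi hf 1
  have hyw : y * ((x - 1) ^ (2 * n) * (y - 1)) = (x - 1) ^ (2 * n) * (y - 1) := by
    linear_combination (x - 1) ^ (2 * n) * hsq - (x - 1) * (y * i) * hx
  have hiw : -(y * i) * ((x - 1) ^ (2 * n) * (y - 1)) = -1 * ((x - 1) ^ (2 * n) * (y - 1)) := by
    linear_combination -i * hyw + i * hxw - ((x - 1) ^ (2 * n) * (y - 1)) * hi
  have hpow : ∀ l : ℕ, (-(y * i)) ^ l * ((x - 1) ^ (2 * n) * (y - 1)) =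
      (-1) ^ l * ((x - 1) ^ (2 * n) * (y - 1)) := by
    intro l
    induction l with
    | zero => simp
    | succ l ih => rw [pow_succ, mul_assoc, hiw, mul_left_comm, ih, pow_succ]; ring
  have hmain : (y - 1) ^ (2 * n + 1) = (-1) ^ n * ((x - 1) ^ (2 * n) * (y - 1)) := by
    rw [← hpow, pow_succ, laplacian_pow_two_mul hi hf]; ring
  refine ⟨hmain, ?_, ?_⟩
  · rw [hmain, mul_left_comm, hxw]
  · rw [hmain, mul_left_comm, hyw]

theorem finrank_quotient_laplacian_of_lt {k : Type*} [Field k] {A B : ℕ} (hA : A ≠ 0)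
    (hB : Odd B) (hAB : A < B) :
    Module.finrank k (MvPolynomial (Fin 2) k ⧸
      Ideal.span {(X 0 * (X 1 - 1) ^ 2 + X 1 * (X 0 - 1) ^ 2 : MvPolynomial (Fin 2) k),
        (X 0 - 1) ^ A, (X 1 - 1) ^ B}) = 2 * A := by
  rw [← (finrank_quotient_laplacian_pow (k := k) hA).1]
  set I := Ideal.span {(X 0 * (X 1 - 1) ^ 2 + X 1 * (X 0 - 1) ^ 2 : MvPolynomial (Fin 2) k),
        (X 0 - 1) ^ A} with hI
  have hmem : ((X 1 - 1) ^ B : MvPolynomial (Fin 2) k) ∈ I := by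
    rw [← Ideal.Quotient.eq_zero_iff_mem]
    rw [map_pow, map_sub, map_one]
    refine laplacian_pow_eq_zero hB hAB (x := Ideal.Quotient.mk I (X 0)) ?_ ?_ <;>
    exact Ideal.Quotient.eq_zero_iff_mem.2 (Ideal.subset_span (by simp))
  have : Ideal.span {(X 0 * (X 1 - 1) ^ 2 + X 1 * (X 0 - 1) ^ 2 : MvPolynomial (Fin 2) k),
        (X 0 - 1) ^ A, (X 1 - 1) ^ B} = I := by
    apply le_antisymm
    · rw [Ideal.span_le]
      rintro _ (rfl | rfl | rfl)
      exacts [Ideal.subset_span (by simp), Ideal.subset_span (by simp), hmem]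
    · exact Ideal.span_mono (by intro; simp; tauto)
  rw [this]

theorem finrank_quotient_laplacian_self {k : Type*} [Field k] {A : ℕ} (hA : Odd A) :
    Module.finrank k (MvPolynomial (Fin 2) k ⧸
      Ideal.span {(X 0 * (X 1 - 1) ^ 2 + X 1 * (X 0 - 1) ^ 2 : MvPolynomial (Fin 2) k),
        (X 0 - 1) ^ A, (X 1 - 1) ^ A}) = 2 * A - 1 := by
  obtain ⟨hdim, hne⟩ := finrank_quotient_laplacian_pow (k := k) hA.pos.ne'
  set I := Ideal.span {(X 0 * (X 1 - 1) ^ 2 + X 1 * (X 0 - 1) ^ 2 : MvPolynomial (Fin 2) k),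
        (X 0 - 1) ^ A} with hI
  obtain ⟨n, rfl⟩ := hA
  have hfin : Module.Finite k (MvPolynomial (Fin 2) k ⧸ I) :=
    Module.finite_of_finrank_pos (by omega)
  obtain ⟨hw, hxw, hyw⟩ := laplacian_pow_self (n := n) (x := Ideal.Quotient.mk I (X 0))
    (y := Ideal.Quotient.mk I (X 1))
    (Ideal.Quotient.eq_zero_iff_mem.2 (Ideal.subset_span (by simp)))
    (Ideal.Quotient.eq_zero_iff_mem.2 (Ideal.subset_span (by simp)))
  set w : MvPolynomial (Fin 2) k ⧸ I := (Ideal.Quotient.mk I (X 1) - 1) ^ (2 * n + 1) with hwdef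
  have hw0 : w ≠ 0 := by
    intro h
    apply hne
    rw [← Ideal.Quotient.eq_zero_iff_mem]
    rw [h] at hw
    rcases neg_one_pow_eq_or (MvPolynomial (Fin 2) k ⧸ I) n with h1 | h1 <;>
      simpa [h1] using hw.symm
  have hspan : (Ideal.span {w}).restrictScalars k = k ∙ w := by
    apply le_antisymm
    · intro z hz
      obtain ⟨t, rfl⟩ := Ideal.mem_span_singleton'.1 hz
      obtain ⟨P, rfl⟩ := Ideal.Quotient.mk_surjective t
      clear hz
      induction P using MvPolynomial.induction_on with
      | C c =>
        exact Submodule.mem_span_singleton.2 ⟨c, Algebra.smul_def c w⟩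
      | add P Q hP hQ => rw [map_add, add_mul]; exact add_mem hP hQ
      | mul_X P j hP =>
        have : Ideal.Quotient.mk I (X j) * w = w := by fin_cases j <;> assumption
        rwa [map_mul, mul_assoc, this]
    · rw [Submodule.span_singleton_le_iff_mem]
      exact Ideal.mem_span_singleton_self w
  have hsup : Ideal.span {(X 0 * (X 1 - 1) ^ 2 + X 1 * (X 0 - 1) ^ 2 : MvPolynomial (Fin 2) k),
        (X 0 - 1) ^ (2 * n + 1), (X 1 - 1) ^ (2 * n + 1)} =
      I ⊔ Ideal.span {(X 1 - 1) ^ (2 * n + 1)} := by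
    rw [hI, ← Ideal.span_union]
    congr 1
    ext; simp; tauto
  have hmap : (Ideal.span {((X 1 - 1) ^ (2 * n + 1) : MvPolynomial (Fin 2) k)}).map
      (Ideal.Quotient.mkₐ k I) = Ideal.span {w} := by
    rw [Ideal.map_span, Set.image_singleton]
    simp [hwdef]
  rw [hsup, ← (DoubleQuot.quotQuotEquivQuotSupₐ k I _).toLinearEquiv.finrank_eq, hmap]
  have hadd := Submodule.finrank_quotient_add_finrank ((Ideal.span {w}).restrictScalars k)
  have hone : Module.finrank k ((Ideal.span {w}).restrictScalars k) = 1 := by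
    rw [hspan, finrank_span_singleton hw0]
  rw [hone, hdim] at hadd
  exact Nat.eq_sub_of_add_eq hadd

/-- At a common zero of the Laplacian relation whose coordinates are `q ^ m`-th roots of unity up
to nilpotents, the cofactor of `x - 1` in `x ^ (q ^ m) - 1` is invertible. -/
theorem isUnit_geom_sum_of_laplacian {p q m : ℕ} [Fact p.Prime] (hpodd : Odd p) (hq : q.Prime)
    (hqodd : Odd q) (hqp : q ≠ p)
    (hord : m ≠ 0 → orderOf (p : ZMod (q ^ m)) = (q ^ m).totient)
    {R : Type*} [CommRing R] [Algebra (ZMod p) R] {x y : R} {A B : ℕ}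
    (hx : (x ^ q ^ m - 1) ^ A = 0) (hy : (y ^ q ^ m - 1) ^ B = 0)
    (hf : x * (y - 1) ^ 2 + y * (x - 1) ^ 2 = 0) :
    IsUnit (∑ j ∈ Finset.range (q ^ m), x ^ j) := by
  rcases eq_or_ne m 0 with rfl | hm
  · simp
  by_contra hunit
  obtain ⟨M, hM, hmem⟩ := exists_max_ideal_of_mem_nonunits hunit
  let _ : Field (R ⧸ M) := Ideal.Quotient.field M
  let K := AlgebraicClosure (R ⧸ M)
  have : CharP K p := charP_of_injective_algebraMap (algebraMap (ZMod p) K).injective p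
  let θ : R →+* K := (algebraMap (R ⧸ M) K).comp (Ideal.Quotient.mk M)
  have hθ : θ (∑ j ∈ Finset.range (q ^ m), x ^ j) = 0 := by
    rw [RingHom.comp_apply, Ideal.Quotient.eq_zero_iff_mem.2 hmem, map_zero]
  have hN0 : q ^ m ≠ 0 := pow_ne_zero _ hq.ne_zero
  have root : ∀ {t : R} {C : ℕ}, (t ^ q ^ m - 1) ^ C = 0 → θ t ^ q ^ m = 1 := fun ht => by
    have := congrArg θ ht
    rw [map_pow, map_zero] at this
    simpa [sub_eq_zero] using eq_zero_of_pow_eq_zero this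
  have ne_zero : ∀ {t : K}, t ^ q ^ m = 1 → t ≠ 0 := by
    rintro _ ht rfl
    exact zero_ne_one ((zero_pow hN0).symm.trans ht)
  have hqK : ((q : ℕ) : K) ≠ 0 := by
    rw [Ne, CharP.cast_eq_zero_iff K p]
    exact fun hd => hqp ((Nat.prime_dvd_prime_iff_eq Fact.out hq).1 hd).symm
  have : NeZero ((q : ℕ) : K) := ⟨hqK⟩
  obtain ⟨ω, hω⟩ := HasEnoughRootsOfUnity.exists_primitiveRoot K q
  have hrel : θ x + (θ x)⁻¹ + θ y + (θ y)⁻¹ = 4 := by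
    refine add_inv_eq_four_of_laplacian (ne_zero (root hx)) (ne_zero (root hy)) ?_
    simpa only [map_add, map_mul, map_pow, map_sub, map_one, map_zero] using congrArg θ hf
  have hx1 : θ x = 1 :=
    eq_one_of_laplacian hpodd hq hqodd hqp hm (hord hm) hω (root hx) (root hy) hrel
  simp [map_sum, hx1, hqK] at hθ

theorem sub_one_pow_eq_zero_of_laplacian {p q m : ℕ} [Fact p.Prime] (hpodd : Odd p)
    (hq : q.Prime) (hqodd : Odd q) (hqp : q ≠ p)
    (hord : m ≠ 0 → orderOf (p : ZMod (q ^ m)) = (q ^ m).totient)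
    {R : Type*} [CommRing R] [Algebra (ZMod p) R] {x y : R} {A B : ℕ}
    (hx : (x ^ q ^ m - 1) ^ A = 0) (hy : (y ^ q ^ m - 1) ^ B = 0)
    (hf : x * (y - 1) ^ 2 + y * (x - 1) ^ 2 = 0) : (x - 1) ^ A = 0 := by
  have hunit := isUnit_geom_sum_of_laplacian hpodd hq hqodd hqp hord hx hy hf
  rwa [← mul_geom_sum, mul_pow, (hunit.pow A).mul_left_eq_zero] at hx

theorem span_laplacian_eq {p q m : ℕ} [Fact p.Prime] (hpodd : Odd p)
    (hq : q.Prime) (hqodd : Odd q) (hqp : q ≠ p)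
    (hord : m ≠ 0 → orderOf (p : ZMod (q ^ m)) = (q ^ m).totient) (a b : ℕ) :
    Ideal.span {(X 0 * (X 1 - 1) ^ 2 + X 1 * (X 0 - 1) ^ 2 : MvPolynomial (Fin 2) (ZMod p)),
        X 0 ^ (p ^ a * q ^ m) - 1, X 1 ^ (p ^ b * q ^ m) - 1} =
      Ideal.span {(X 0 * (X 1 - 1) ^ 2 + X 1 * (X 0 - 1) ^ 2 : MvPolynomial (Fin 2) (ZMod p)),
        (X 0 - 1) ^ p ^ a, (X 1 - 1) ^ p ^ b} := by
  have hpow : ∀ (j : Fin 2) (c : ℕ), (X j ^ (p ^ c * q ^ m) - 1 : MvPolynomial (Fin 2) (ZMod p)) =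
      (X j ^ q ^ m - 1) ^ p ^ c := fun j c => by
    rw [sub_pow_char_pow, one_pow, ← pow_mul, mul_comm]
  simp only [hpow]
  set I := Ideal.span {(X 0 * (X 1 - 1) ^ 2 + X 1 * (X 0 - 1) ^ 2 :
    MvPolynomial (Fin 2) (ZMod p)), (X 0 ^ q ^ m - 1) ^ p ^ a, (X 1 ^ q ^ m - 1) ^ p ^ b} with hI
  apply le_antisymm
  · rw [hI, Ideal.span_le]
    rintro _ (rfl | rfl | rfl)
    · exact Ideal.subset_span (by simp)
    · rw [← mul_geom_sum, mul_pow]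
      exact Ideal.mul_mem_right _ _ (Ideal.subset_span (by simp))
    · rw [← mul_geom_sum, mul_pow]
      exact Ideal.mul_mem_right _ _ (Ideal.subset_span (by simp))
  · set x := Ideal.Quotient.mk I (X 0)
    set y := Ideal.Quotient.mk I (X 1)
    have hf : x * (y - 1) ^ 2 + y * (x - 1) ^ 2 = 0 :=
      Ideal.Quotient.eq_zero_iff_mem.2 (Ideal.subset_span (by simp))
    have hx : (x ^ q ^ m - 1) ^ p ^ a = 0 :=
      Ideal.Quotient.eq_zero_iff_mem.2 (Ideal.subset_span (by simp))
    have hy : (y ^ q ^ m - 1) ^ p ^ b = 0 :=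
      Ideal.Quotient.eq_zero_iff_mem.2 (Ideal.subset_span (by simp))
    rw [Ideal.span_le]
    rintro _ (rfl | rfl | rfl)
    · exact Ideal.subset_span (by simp)
    · exact Ideal.Quotient.eq_zero_iff_mem.1
        (sub_one_pow_eq_zero_of_laplacian hpodd hq hqodd hqp hord hx hy hf)
    · exact Ideal.Quotient.eq_zero_iff_mem.1
        (sub_one_pow_eq_zero_of_laplacian hpodd hq hqodd hqp hord hy hx (by rwa [add_comm]))

/-- Exchanging the two variables. -/
theorem finrank_quotient_laplacian_comm {k : Type*} [Field k] (A B : ℕ) :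
    Module.finrank k (MvPolynomial (Fin 2) k ⧸
      Ideal.span {(X 0 * (X 1 - 1) ^ 2 + X 1 * (X 0 - 1) ^ 2 : MvPolynomial (Fin 2) k),
        (X 0 - 1) ^ A, (X 1 - 1) ^ B}) =
    Module.finrank k (MvPolynomial (Fin 2) k ⧸
      Ideal.span {(X 0 * (X 1 - 1) ^ 2 + X 1 * (X 0 - 1) ^ 2 : MvPolynomial (Fin 2) k),
        (X 0 - 1) ^ B, (X 1 - 1) ^ A}) := by
  refine (Ideal.quotientEquivAlg _ _ (renameEquiv k (Equiv.swap (0 : Fin 2) 1))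
    ?_).toLinearEquiv.finrank_eq
  rw [Ideal.map_span]
  simp only [Set.image_insert_eq, Set.image_singleton]
  simp only [RingHom.coe_coe, renameEquiv_apply, map_add, map_mul,
    map_pow, map_sub, map_one, rename_X, Equiv.swap_apply_left, Equiv.swap_apply_right]
  rw [add_comm (X 1 * _)]
  congr 1
  ext; simp; tauto

/-- For an odd prime `p`, an odd prime `q ≠ p`, an integer `m ≥ 0` such that `p` is a
primitive root modulo `q^m` whenever `m ≥ 1`, and nonnegative integers `kx, ky`, setting
`Lx = p^kx · q^m` and `Ly = p^ky · q^m`, the dimension over `ZMod p` of the quotient of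
`(ZMod p)[x,y]` by the ideal generated by the square-lattice Laplacian polynomial
`f(x,y) = x·(y-1)² + y·(x-1)²`, `x^Lx - 1`, and `y^Ly - 1` equals
`2·p^(min kx ky) - 1` when `kx = ky`, and `2·p^(min kx ky)` otherwise. -/
theorem square_laplacian_gsd_mod_p (p q m : ℕ) (hp : p.Prime) (hpodd : Odd p)
    (hq : q.Prime) (hqodd : Odd q) (hqp : q ≠ p)
    (hprim : 1 ≤ m → Nat.Coprime p (q ^ m) ∧
      orderOf ((p : ℕ) : ZMod (q ^ m)) = Nat.totient (q ^ m))
    (kx ky : ℕ) :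
    Module.finrank (ZMod p)
      (MvPolynomial (Fin 2) (ZMod p) ⧸
        Ideal.span {(X 0 * (X 1 - 1) ^ 2 + X 1 * (X 0 - 1) ^ 2 :
            MvPolynomial (Fin 2) (ZMod p)),
          X 0 ^ (p ^ kx * q ^ m) - 1, X 1 ^ (p ^ ky * q ^ m) - 1}) =
      if kx = ky then 2 * p ^ min kx ky - 1 else 2 * p ^ min kx ky := by
  have : Fact p.Prime := ⟨hp⟩
  rw [span_laplacian_eq hpodd hq hqodd hqp fun hm => (hprim (Nat.one_le_iff_ne_zero.2 hm)).2]
  rcases lt_trichotomy kx ky with h | rfl | h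
  · rw [if_neg h.ne, min_eq_left h.le]
    exact finrank_quotient_laplacian_of_lt (pow_ne_zero _ hp.ne_zero) hpodd.pow
      (Nat.pow_lt_pow_right hp.one_lt h)
  · rw [if_pos rfl, min_self]
    exact finrank_quotient_laplacian_self hpodd.pow
  · rw [if_neg h.ne', min_eq_right h.le, finrank_quotient_laplacian_comm]
    exact finrank_quotient_laplacian_of_lt (pow_ne_zero _ hp.ne_zero) hpodd.pow
      (Nat.pow_lt_pow_right hp.one_lt h)
end
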